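/- arXiv:1612.03080 — 2 statements merged into one kernel-verified Lean document; each statement's English description precedes it below -/
import Mathlib

section
/- Let n₁, n₂ ≥ 1 and n = n₁n₂. The range of the two-dimensional discrete periodic divergence div (mapping pairs of fields over ZMod n₁ × ZMod n₂ to images) is exactly the set of images z with ∑_{i,j} z_{i,j} = 0. In particular, for every y the set {(v, w) : div(v, w) = y − ȳ𝟙} is nonempty. -/
/-- Discrete periodic divergence in 2D applied to a pair of fields `(v, w)`:
`(div (v, w))_{i,j} = v_{i-1,j} - v_{i,j} + w_{i,j-1} - w_{i,j}`. -/
noncomputable def div2 (n₁ n₂ : ℕ)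
    (vw : (ZMod n₁ × ZMod n₂ → ℝ) × (ZMod n₁ × ZMod n₂ → ℝ)) :
    ZMod n₁ × ZMod n₂ → ℝ :=
  fun p => vw.1 (p.1 - 1, p.2) - vw.1 p + (vw.2 (p.1, p.2 - 1) - vw.2 p)

/-- Mean of an image indexed by `ZMod n₁ × ZMod n₂`. -/
noncomputable def mean2 (n₁ n₂ : ℕ) [NeZero n₁] [NeZero n₂]
    (y : ZMod n₁ × ZMod n₂ → ℝ) : ℝ :=
  (∑ p, y p) / (n₁ * n₂)

theorem sum_range_zmod (n : ℕ) [NeZero n] (f : ZMod n → ℝ) :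
    ∑ k ∈ Finset.range n, f (k : ZMod n) = ∑ i, f i := by
  refine Finset.sum_bij (fun k _ => (k : ZMod n)) (fun _ _ => Finset.mem_univ _) ?_ ?_ ?_
  · intro a ha b hb h
    have := congrArg ZMod.val h
    rwa [ZMod.val_cast_of_lt (Finset.mem_range.1 ha),
      ZMod.val_cast_of_lt (Finset.mem_range.1 hb)] at this
  · intro b _
    exact ⟨b.val, Finset.mem_range.2 (ZMod.val_lt b), ZMod.natCast_zmod_val b⟩
  · intros
    rfl

theorem exists_diff (n : ℕ) [NeZero n] (f : ZMod n → ℝ) (hf : ∑ i, f i = 0) :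
    ∃ g : ZMod n → ℝ, ∀ i, g (i - 1) - g i = f i := by
  refine ⟨fun i => -∑ k ∈ Finset.range (i.val + 1), f (k : ZMod n), fun i => ?_⟩
  have key : ∑ k ∈ Finset.range ((i - 1).val + 1), f (k : ZMod n)
      = ∑ k ∈ Finset.range i.val, f (k : ZMod n) := by
    have hm : (((i - 1).val + 1 : ℕ) : ZMod n) = i := by
      push_cast
      rw [ZMod.natCast_zmod_val]
      ring
    have hlt := ZMod.val_lt (i - 1)
    rcases Nat.lt_or_ge ((i - 1).val + 1) n with h | h
    · have h2 := ZMod.val_cast_of_lt h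
      rw [hm] at h2
      rw [h2]
    · have h3 : (i - 1).val + 1 = n := by omega
      rw [h3] at hm ⊢
      rw [ZMod.natCast_self] at hm
      rw [sum_range_zmod, hf, ← hm]
      simp
  simp only [key, Finset.sum_range_succ _ i.val, ZMod.natCast_zmod_val]
  ring

theorem exists_div2 (n₁ n₂ : ℕ) [NeZero n₁] [NeZero n₂] (z : ZMod n₁ × ZMod n₂ → ℝ)
    (hz : ∑ p, z p = 0) : ∃ vw, div2 n₁ n₂ vw = z := by
  have h2 : (n₂ : ℝ) ≠ 0 := Nat.cast_ne_zero.2 (NeZero.ne n₂)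
  obtain ⟨v, hv⟩ := exists_diff n₁ (fun i => (∑ j, z (i, j)) / n₂) (by
    rw [← Finset.sum_div, ← Fintype.sum_prod_type', hz, zero_div])
  have hw := fun i => exists_diff n₂ (fun j => z (i, j) - (∑ j, z (i, j)) / n₂) (by
    rw [Finset.sum_sub_distrib]
    simp only [Finset.sum_const, Finset.card_univ, ZMod.card, nsmul_eq_mul]
    field_simp
    ring)
  choose w hw using hw
  refine ⟨(fun p => v p.1, fun p => w p.1 p.2), ?_⟩
  funext p
  simp only [div2]
  rw [hv, hw]
  ring

theorem sum_div2 (n₁ n₂ : ℕ) [NeZero n₁] [NeZero n₂]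
    (vw : (ZMod n₁ × ZMod n₂ → ℝ) × (ZMod n₁ × ZMod n₂ → ℝ)) :
    ∑ p, div2 n₁ n₂ vw p = 0 := by
  have e1 : ∑ p : ZMod n₁ × ZMod n₂, vw.1 (p.1 - 1, p.2) = ∑ p, vw.1 p :=
    Equiv.sum_comp ((Equiv.subRight (1 : ZMod n₁)).prodCongr (Equiv.refl (ZMod n₂))) vw.1
  have e2 : ∑ p : ZMod n₁ × ZMod n₂, vw.2 (p.1, p.2 - 1) = ∑ p, vw.2 p :=
    Equiv.sum_comp ((Equiv.refl (ZMod n₁)).prodCongr (Equiv.subRight (1 : ZMod n₂))) vw.2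
  simp only [div2, Finset.sum_add_distrib, Finset.sum_sub_distrib, e1, e2]
  ring

theorem stmt5 (n₁ n₂ : ℕ) [NeZero n₁] [NeZero n₂] (hn₁ : 1 ≤ n₁) (hn₂ : 1 ≤ n₂) :
    Set.range (div2 n₁ n₂) = {z : ZMod n₁ × ZMod n₂ → ℝ | ∑ p, z p = 0} ∧
      ∀ y : ZMod n₁ × ZMod n₂ → ℝ,
        {vw : (ZMod n₁ × ZMod n₂ → ℝ) × (ZMod n₁ × ZMod n₂ → ℝ) |
          div2 n₁ n₂ vw = fun p => y p - mean2 n₁ n₂ y}.Nonempty := by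
  refine ⟨?_, fun y => ?_⟩
  · ext z
    constructor
    · rintro ⟨vw, rfl⟩
      exact sum_div2 n₁ n₂ vw
    · intro hz
      exact exists_div2 n₁ n₂ z hz
  · refine exists_div2 n₁ n₂ _ ?_
    have h1 : (n₁ : ℝ) ≠ 0 := Nat.cast_ne_zero.2 (NeZero.ne n₁)
    have h2 : (n₂ : ℝ) ≠ 0 := Nat.cast_ne_zero.2 (NeZero.ne n₂)
    rw [Finset.sum_sub_distrib]
    simp only [Finset.sum_const, Finset.card_univ, Fintype.card_prod, ZMod.card, nsmul_eq_mul,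
      mean2, Nat.cast_mul]
    field_simp
    ring
end

section
/- Let n₁, n₂ ≥ 1 and n = n₁n₂. The kernel of the two-dimensional discrete periodic divergence div, viewed as a linear map from the 2n-dimensional space of pairs of fields over ZMod n₁ × ZMod n₂ to ℝ^{ZMod n₁ × ZMod n₂}, has dimension n + 1. -/
/-- Discrete periodic divergence in 2D as a linear map from pairs of fields to images:
`(div (v, w))_{i,j} = v_{i-1,j} - v_{i,j} + w_{i,j-1} - w_{i,j}`. -/
noncomputable def div2L (n₁ n₂ : ℕ) :
    ((ZMod n₁ × ZMod n₂ → ℝ) × (ZMod n₁ × ZMod n₂ → ℝ)) →ₗ[ℝ]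
      (ZMod n₁ × ZMod n₂ → ℝ) where
  toFun vw := fun p => vw.1 (p.1 - 1, p.2) - vw.1 p + (vw.2 (p.1, p.2 - 1) - vw.2 p)
  map_add' a b := by
    funext p
    simp only [Prod.fst_add, Prod.snd_add, Pi.add_apply]
    ring
  map_smul' c a := by
    funext p
    simp only [Prod.smul_fst, Prod.smul_snd, Pi.smul_apply, smul_eq_mul, RingHom.id_apply]
    ring

theorem div2L_stepL (n₁ n₂ : ℕ) [NeZero n₁] [NeZero n₂] (i : ZMod n₁) (j : ZMod n₂) :
    (Pi.single (i + 1, j) 1 - Pi.single (i, j) 1 : ZMod n₁ × ZMod n₂ → ℝ)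
      ∈ LinearMap.range (div2L n₁ n₂) := by
  classical
  refine ⟨(Pi.single (i, j) 1, 0), ?_⟩
  funext p
  obtain ⟨a, b⟩ := p
  simp [div2L, Pi.single_apply, sub_eq_iff_eq_add]

theorem div2L_stepR (n₁ n₂ : ℕ) [NeZero n₁] [NeZero n₂] (i : ZMod n₁) (j : ZMod n₂) :
    (Pi.single (i, j + 1) 1 - Pi.single (i, j) 1 : ZMod n₁ × ZMod n₂ → ℝ)
      ∈ LinearMap.range (div2L n₁ n₂) := by
  classical
  refine ⟨(0, Pi.single (i, j) 1), ?_⟩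
  funext p
  obtain ⟨a, b⟩ := p
  simp [div2L, Pi.single_apply, sub_eq_iff_eq_add]

theorem div2L_single (n₁ n₂ : ℕ) [NeZero n₁] [NeZero n₂] (p : ZMod n₁ × ZMod n₂) :
    (Pi.single p 1 - Pi.single (0, 0) 1 : ZMod n₁ × ZMod n₂ → ℝ)
      ∈ LinearMap.range (div2L n₁ n₂) := by
  obtain ⟨a, b⟩ := p
  have h1 : ∀ k : ℕ, (Pi.single ((k : ZMod n₁), (0 : ZMod n₂)) 1 - Pi.single (0, 0) 1 :
      ZMod n₁ × ZMod n₂ → ℝ) ∈ LinearMap.range (div2L n₁ n₂) := by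
    intro k
    induction k with
    | zero => simp
    | succ k ih =>
      have := add_mem (div2L_stepL n₁ n₂ (k : ZMod n₁) 0) ih
      rw [sub_add_sub_cancel] at this
      rwa [Nat.cast_succ]
  have h2 : ∀ k : ℕ, (Pi.single (a, (k : ZMod n₂)) 1 - Pi.single (0, 0) 1 :
      ZMod n₁ × ZMod n₂ → ℝ) ∈ LinearMap.range (div2L n₁ n₂) := by
    intro k
    induction k with
    | zero =>
      have := h1 a.val
      rw [ZMod.natCast_zmod_val] at this
      rwa [Nat.cast_zero]
    | succ k ih =>
      have := add_mem (div2L_stepR n₁ n₂ a (k : ZMod n₂)) ih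
      rw [sub_add_sub_cancel] at this
      rwa [Nat.cast_succ]
  have := h2 b.val
  rwa [ZMod.natCast_zmod_val] at this

/-- The sum of all values of an image. -/
noncomputable def sumL (ι : Type) [Fintype ι] : (ι → ℝ) →ₗ[ℝ] ℝ :=
  ∑ p, LinearMap.proj p

theorem sumL_apply (ι : Type) [Fintype ι] (f : ι → ℝ) : sumL ι f = ∑ p, f p := by
  simp [sumL]

theorem div2L_range (n₁ n₂ : ℕ) [NeZero n₁] [NeZero n₂] :
    LinearMap.range (div2L n₁ n₂) = LinearMap.ker (sumL (ZMod n₁ × ZMod n₂)) := by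
  apply le_antisymm
  · rintro _ ⟨⟨v, w⟩, rfl⟩
    rw [LinearMap.mem_ker, sumL_apply]
    have hv : ∑ p : ZMod n₁ × ZMod n₂, v (p.1 - 1, p.2) = ∑ p, v p :=
      Equiv.sum_comp ((Equiv.subRight (1 : ZMod n₁)).prodCongr (Equiv.refl (ZMod n₂))) v
    have hw : ∑ p : ZMod n₁ × ZMod n₂, w (p.1, p.2 - 1) = ∑ p, w p :=
      Equiv.sum_comp ((Equiv.refl (ZMod n₁)).prodCongr (Equiv.subRight (1 : ZMod n₂))) w
    simp [div2L, Finset.sum_add_distrib, Finset.sum_sub_distrib, hv, hw]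
  · intro f hf
    rw [LinearMap.mem_ker, sumL_apply] at hf
    have key : f = ∑ p, f p • (Pi.single p 1 - Pi.single (0, 0) 1 :
        ZMod n₁ × ZMod n₂ → ℝ) := by
      simp_rw [smul_sub]
      rw [Finset.sum_sub_distrib, ← Finset.sum_smul, hf, zero_smul, sub_zero]
      exact pi_eq_sum_univ' f
    rw [key]
    exact Submodule.sum_mem _ fun p _ => Submodule.smul_mem _ _ (div2L_single n₁ n₂ p)

theorem stmt7 (n₁ n₂ : ℕ) [NeZero n₁] [NeZero n₂] (hn₁ : 1 ≤ n₁) (hn₂ : 1 ≤ n₂) :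
    Module.finrank ℝ (LinearMap.ker (div2L n₁ n₂)) = n₁ * n₂ + 1 := by
  have e1 := LinearMap.finrank_range_add_finrank_ker (div2L n₁ n₂)
  have e2 := LinearMap.finrank_range_add_finrank_ker (sumL (ZMod n₁ × ZMod n₂))
  have hs : LinearMap.range (sumL (ZMod n₁ × ZMod n₂)) = ⊤ := by
    rw [LinearMap.range_eq_top]
    intro c
    exact ⟨Pi.single 0 c, by rw [sumL_apply]; simp⟩
  rw [hs, finrank_top, Module.finrank_self, ← div2L_range] at e2
  rw [Module.finrank_prod] at e1
  simp only [Module.finrank_fintype_fun_eq_card, Fintype.card_prod, ZMod.card] at e1 e2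
  omega
end
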